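/- For every 0 < a < b < 1 and α > 0, and for every λ ∈ (−1, 1], every real k > 0 with s = ik, and every β > 0, the operators T(a, b, α) and B(λ, s, β) on ℓ²(ℤ,ℂ) ⊕ ℓ²(ℤ,ℂ) are not unitarily equivalent. -/

import Mathlib

noncomputable section

open ContinuousLinearMap

/-- The Hilbert space `ℓ²(ℤ, ℂ)`. -/
abbrev H : Type := lp (fun _ : ℤ => ℂ) 2

/-- The standard orthonormal basis vectors of `ℓ²(ℤ, ℂ)`. -/
def e (n : ℤ) : H := lp.single 2 n 1

/-- The `2 × 2` upper-triangular block operator `[[T₁, S], [0, T₂]]` on the Hilbert space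
direct sum `E ⊕ E = WithLp 2 (E × E)`. -/
def blockOp {E : Type*} [NormedAddCommGroup E] [NormedSpace ℂ E]
    (T₁ S T₂ : E →L[ℂ] E) : WithLp 2 (E × E) →L[ℂ] WithLp 2 (E × E) :=
  ((WithLp.prodContinuousLinearEquiv 2 ℂ E E).symm :
      E × E →L[ℂ] WithLp 2 (E × E)) ∘L
    ((((T₁ ∘L fst ℂ E E) + (S ∘L snd ℂ E E)).prod (T₂ ∘L snd ℂ E E)) ∘L
      ((WithLp.prodContinuousLinearEquiv 2 ℂ E E) :
        WithLp 2 (E × E) →L[ℂ] E × E))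

/-- Unitary equivalence of bounded operators on (possibly different) complex Hilbert spaces:
there is a unitary (= surjective linear isometry) `U` with `U A U⁻¹ = B`. -/
def UnitarilyEquiv {E F : Type*} [NormedAddCommGroup E] [NormedSpace ℂ E]
    [NormedAddCommGroup F] [NormedSpace ℂ F] (A : E →L[ℂ] E) (B : F →L[ℂ] F) : Prop :=
  ∃ U : E ≃ₗᵢ[ℂ] F, ∀ x, U (A x) = B (U x)

/-- The Möbius transform `e^{iθ} (T - c·1)(1 - c̄·T)⁻¹` of an operator. -/
def mobius {E : Type*} [NormedAddCommGroup E] [NormedSpace ℂ E] [CompleteSpace E]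
    (θ : ℝ) (c : ℂ) (T : E →L[ℂ] E) : E →L[ℂ] E :=
  Complex.exp (θ * Complex.I) •
    ((T - c • (1 : E →L[ℂ] E)) * Ring.inverse (1 - (starRingEnd ℂ c) • T))

/-- A bounded operator on a complex Hilbert space is homogeneous if its spectrum lies in the
closed unit disc and all its Möbius transforms are unitarily equivalent to it. -/
def Homogeneous {E : Type*} [NormedAddCommGroup E] [NormedSpace ℂ E] [CompleteSpace E]
    (T : E →L[ℂ] E) : Prop :=
  spectrum ℂ T ⊆ Metric.closedBall 0 1 ∧
    ∀ (θ : ℝ) (c : ℂ), ‖c‖ < 1 →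
      IsUnit (1 - (starRingEnd ℂ c) • T) ∧ UnitarilyEquiv (mobius θ c T) T

/-- A bounded operator is irreducible if the only closed subspaces invariant under both the
operator and its adjoint are `{0}` and the whole space. -/
def IrreducibleOp {E : Type*} [NormedAddCommGroup E] [InnerProductSpace ℂ E] [CompleteSpace E]
    (T : E →L[ℂ] E) : Prop :=
  ∀ M : Submodule ℂ E, IsClosed (M : Set E) → (∀ x ∈ M, T x ∈ M) →
    (∀ x ∈ M, ContinuousLinearMap.adjoint T x ∈ M) → M = ⊥ ∨ M = ⊤

/-- Weight sequence of the shift `B_{λ, ia}`. -/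
def wB (l a : ℝ) (n : ℤ) : ℂ :=
  ((n : ℂ) + (1 + (l : ℂ)) / 2 + Complex.I * (a : ℂ)) /
    ((n : ℂ) + (1 + (l : ℂ)) / 2 - Complex.I * (a : ℂ))

/-- Weight sequence of the shift `T(a, b)`. -/
def wT (a b : ℝ) (n : ℤ) : ℂ := (Real.sqrt (((n : ℝ) + a) / ((n : ℝ) + b)) : ℂ)

/-- Weight sequence of the shift `S[λ]`. -/
def wS (l : ℝ) (n : ℤ) : ℂ := ((l : ℂ) + 2 * (n : ℂ) + 1)⁻¹

open ComplexConjugate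

lemma inner_e (n : ℤ) (x : H) : inner ℂ (e n) x = x n := by
  simp [e, lp.inner_single_left]

lemma e_apply_self (n : ℤ) : (e n : ℤ → ℂ) n = 1 := by
  simp [e]

lemma e_apply_of_ne {m n : ℤ} (h : m ≠ n) : (e n : ℤ → ℂ) m = 0 := by
  simp [e, lp.single_apply, h]

/-- `T` is the weighted bilateral shift with weight sequence `w`. -/
def IsShift (w : ℤ → ℂ) (T : H →L[ℂ] H) : Prop :=
  ∀ n : ℤ, T (e n) = w n • e (n + 1)

namespace IsShift

variable {w : ℤ → ℂ} {T : H →L[ℂ] H}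

lemma adjoint_apply (hT : IsShift w T) (x : H) (n : ℤ) :
    adjoint T x n = conj (w n) * x (n + 1) := by
  rw [← inner_e, adjoint_inner_right, hT n, inner_smul_left, inner_e]

lemma apply_succ (hT : IsShift w T) (x : H) (n : ℤ) : T x (n + 1) = w n * x n := by
  have h : adjoint T (e (n + 1)) = conj (w n) • e n := by
    ext m
    rw [hT.adjoint_apply]
    by_cases hm : m = n
    · subst hm
      simp [e_apply_self]
    · simp [e_apply_of_ne hm, e_apply_of_ne (show m + 1 ≠ n + 1 by simpa using hm)]
  rw [← inner_e, ← adjoint_inner_left, h, inner_smul_left, inner_e, Complex.conj_conj]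

lemma smul_sub {w' : ℤ → ℂ} {T' : H →L[ℂ] H} (hT : IsShift w T) (hT' : IsShift w' T') (c : ℂ) :
    IsShift (fun n => c * (w n - w' n)) (c • (T - T')) := by
  intro n
  simp [hT n, hT' n, ← sub_smul, smul_smul]

end IsShift

lemma adjoint_blockOp {E : Type*} [NormedAddCommGroup E] [InnerProductSpace ℂ E]
    [CompleteSpace E] (T₁ S T₂ : E →L[ℂ] E) (z : WithLp 2 (E × E)) :
    adjoint (blockOp T₁ S T₂) z =
      WithLp.toLp 2 (adjoint T₁ z.fst, adjoint S z.fst + adjoint T₂ z.snd) := by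
  refine ext_inner_left ℂ fun v => ?_
  rw [adjoint_inner_right]
  simp [blockOp, WithLp.prod_inner_apply, adjoint_inner_right, inner_add_left, inner_add_right,
    add_assoc]

/-- Unitary equivalence also intertwines the adjoints. -/
lemma intertwine_adjoint {E F : Type*} [NormedAddCommGroup E] [InnerProductSpace ℂ E]
    [CompleteSpace E] [NormedAddCommGroup F] [InnerProductSpace ℂ F] [CompleteSpace F]
    {A : E →L[ℂ] E} {B : F →L[ℂ] F} {U : E ≃ₗᵢ[ℂ] F} (h : ∀ x, U (A x) = B (U x)) (x : E) :
    U (adjoint A x) = adjoint B (U x) := by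
  refine ext_inner_left ℂ fun v => ?_
  obtain ⟨v, rfl⟩ := U.surjective v
  rw [adjoint_inner_right, ← h, U.inner_map_map, U.inner_map_map, adjoint_inner_right]

/-- The quadratic polynomial `X² - t X + 1` evaluated at `A* A`. -/
def gramQuadratic {E : Type*} [NormedAddCommGroup E] [InnerProductSpace ℂ E]
    [CompleteSpace E] (A : E →L[ℂ] E) (t : ℂ) (z : E) : E :=
  adjoint A (A (adjoint A (A z))) - t • adjoint A (A z) + z

lemma map_gramQuadratic {E F : Type*} [NormedAddCommGroup E] [InnerProductSpace ℂ E]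
    [CompleteSpace E] [NormedAddCommGroup F] [InnerProductSpace ℂ F] [CompleteSpace F]
    {A : E →L[ℂ] E} {B : F →L[ℂ] F} {U : E ≃ₗᵢ[ℂ] F} (h : ∀ x, U (A x) = B (U x)) (t : ℂ)
    (z : E) : U (gramQuadratic A t z) = gramQuadratic B t (U z) := by
  simp only [gramQuadratic, map_add, map_sub, map_smul, intertwine_adjoint h, h]

/-- The `n`-th coordinate of `z`, a vector of `ℂ²`, vanishes. -/
def VanishesAt (z : WithLp 2 (H × H)) (n : ℤ) : Prop :=
  z.fst n = 0 ∧ z.snd n = 0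

/-- `A` is the `2 × 2` upper triangular block shift whose `n`-th block is
`[[p n, q n], [0, r n]]`. -/
structure IsBlockShift (p q r : ℤ → ℂ) (A : WithLp 2 (H × H) →L[ℂ] WithLp 2 (H × H)) : Prop where
  fst_succ : ∀ z n, (A z).fst (n + 1) = p n * z.fst n + q n * z.snd n
  snd_succ : ∀ z n, (A z).snd (n + 1) = r n * z.snd n
  adjoint_fst : ∀ z n, (adjoint A z).fst n = conj (p n) * z.fst (n + 1)
  adjoint_snd : ∀ z n, (adjoint A z).snd n =
    conj (q n) * z.fst (n + 1) + conj (r n) * z.snd (n + 1)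

lemma isBlockShift_blockOp {p q r : ℤ → ℂ} {T₁ S T₂ : H →L[ℂ] H} (h₁ : IsShift p T₁)
    (hS : IsShift q S) (h₂ : IsShift r T₂) : IsBlockShift p q r (blockOp T₁ S T₂) where
  fst_succ z n := by
    rw [← h₁.apply_succ, ← hS.apply_succ]; simp [blockOp]
  snd_succ z n := by
    rw [← h₂.apply_succ]; simp [blockOp]
  adjoint_fst z n := by
    rw [← h₁.adjoint_apply, adjoint_blockOp]; rfl
  adjoint_snd z n := by
    rw [← hS.adjoint_apply, ← h₂.adjoint_apply, adjoint_blockOp]; simp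

/-- The trace of `Aₙ* Aₙ` for `Aₙ = [[p n, q n], [0, r n]]`. -/
def gramTrace (p q r : ℤ → ℂ) (n : ℤ) : ℝ :=
  Complex.normSq (p n) + Complex.normSq (q n) + Complex.normSq (r n)

namespace IsBlockShift

variable {p q r : ℤ → ℂ} {A : WithLp 2 (H × H) →L[ℂ] WithLp 2 (H × H)}

/-- Cayley–Hamilton for the blocks of `A* A`, which have determinant one. -/
lemma gramQuadratic_coord (hA : IsBlockShift p q r A)
    (hdet : ∀ n, Complex.normSq (p n) * Complex.normSq (r n) = 1) (t : ℂ)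
    (z : WithLp 2 (H × H)) (n : ℤ) :
    (gramQuadratic A t z).fst n = (gramTrace p q r n - t) * (adjoint A (A z)).fst n ∧
      (gramQuadratic A t z).snd n = (gramTrace p q r n - t) * (adjoint A (A z)).snd n := by
  have hd : conj (p n) * p n * (conj (r n) * r n) = 1 := by
    rw [← Complex.normSq_eq_conj_mul_self, ← Complex.normSq_eq_conj_mul_self]
    exact_mod_cast hdet n
  simp only [gramQuadratic, gramTrace, WithLp.add_fst, WithLp.sub_fst, WithLp.smul_fst,
    WithLp.add_snd, WithLp.sub_snd, WithLp.smul_snd, lp.coeFn_add, lp.coeFn_sub, lp.coeFn_smul,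
    Pi.add_apply, Pi.sub_apply, Pi.smul_apply, smul_eq_mul, hA.adjoint_fst, hA.adjoint_snd,
    hA.fst_succ, hA.snd_succ, Complex.ofReal_add, Complex.normSq_eq_conj_mul_self]
  constructor
  · linear_combination (-z.fst n) * hd
  · linear_combination (-z.snd n) * hd

lemma ne_zero (hdet : ∀ n, Complex.normSq (p n) * Complex.normSq (r n) = 1) (n : ℤ) :
    p n ≠ 0 ∧ r n ≠ 0 := by
  constructor <;> intro h <;> simpa [h] using hdet n

lemma vanishesAt_of_apply (hA : IsBlockShift p q r A)
    (hdet : ∀ n, Complex.normSq (p n) * Complex.normSq (r n) = 1)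
    {z : WithLp 2 (H × H)} {n : ℤ} (h : VanishesAt (A z) (n + 1)) : VanishesAt z n := by
  obtain ⟨h1, h2⟩ := h
  obtain ⟨hp, hr⟩ := ne_zero hdet n
  rw [hA.snd_succ] at h2
  have hv : z.snd n = 0 := (mul_eq_zero.mp h2).resolve_left hr
  rw [hA.fst_succ, hv, mul_zero, add_zero] at h1
  exact ⟨(mul_eq_zero.mp h1).resolve_left hp, hv⟩

lemma vanishesAt_of_adjoint (hA : IsBlockShift p q r A)
    (hdet : ∀ n, Complex.normSq (p n) * Complex.normSq (r n) = 1)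
    {z : WithLp 2 (H × H)} {n : ℤ} (h : VanishesAt (adjoint A z) n) : VanishesAt z (n + 1) := by
  obtain ⟨h1, h2⟩ := h
  obtain ⟨hp, hr⟩ := ne_zero hdet n
  rw [hA.adjoint_fst] at h1
  have hu : z.fst (n + 1) = 0 := (mul_eq_zero.mp h1).resolve_left (by simpa using hp)
  rw [hA.adjoint_snd, hu, mul_zero, zero_add] at h2
  exact ⟨hu, (mul_eq_zero.mp h2).resolve_left (by simpa using hr)⟩

lemma vanishesAt_apply (hA : IsBlockShift p q r A) {z : WithLp 2 (H × H)} {n : ℤ}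
    (h : VanishesAt z n) : VanishesAt (A z) (n + 1) := by
  simp [VanishesAt, hA.fst_succ, hA.snd_succ, h.1, h.2]

lemma gramQuadratic_eq_zero (hA : IsBlockShift p q r A)
    (hdet : ∀ n, Complex.normSq (p n) * Complex.normSq (r n) = 1)
    {z : WithLp 2 (H × H)} {n : ℤ} (hz : ∀ m ≠ n, VanishesAt z m) :
    gramQuadratic A (gramTrace p q r n) z = 0 := by
  have key (m : ℤ) : VanishesAt (gramQuadratic A (gramTrace p q r n) z) m := by
    obtain ⟨h1, h2⟩ := hA.gramQuadratic_coord hdet (gramTrace p q r n) z m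
    rw [VanishesAt, h1, h2]
    by_cases hm : m = n
    · simp [hm]
    · have := hA.vanishesAt_apply (hz m hm)
      simp [hA.adjoint_fst, hA.adjoint_snd, this.1, this.2]
  refine WithLp.ofLp_injective 2 (Prod.ext ?_ ?_)
  · ext m
    exact (key m).1
  · ext m
    exact (key m).2

lemma gramTrace_eq (hA : IsBlockShift p q r A)
    (hdet : ∀ n, Complex.normSq (p n) * Complex.normSq (r n) = 1) {t : ℝ}
    {z : WithLp 2 (H × H)} {n : ℤ} (hz : ¬ VanishesAt z n) (h : gramQuadratic A t z = 0) :
    gramTrace p q r n = t := by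
  by_contra hne
  obtain ⟨h1, h2⟩ := hA.gramQuadratic_coord hdet t z n
  have hne' : (gramTrace p q r n : ℂ) - t ≠ 0 := by
    rw [sub_ne_zero]
    exact_mod_cast hne
  rw [h] at h1 h2
  exact hz <| hA.vanishesAt_of_apply hdet <| hA.vanishesAt_of_adjoint hdet
    ⟨(mul_eq_zero.mp h1.symm).resolve_left hne', (mul_eq_zero.mp h2.symm).resolve_left hne'⟩

/-- The trace sequences of unitarily equivalent block shifts with unimodular determinants agree
on a half line, up to a translation. -/
lemma exists_gramTrace_eq {p' q' r' : ℤ → ℂ} {B : WithLp 2 (H × H) →L[ℂ] WithLp 2 (H × H)}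
    (hA : IsBlockShift p q r A) (hB : IsBlockShift p' q' r' B)
    (hdet : ∀ n, Complex.normSq (p n) * Complex.normSq (r n) = 1)
    (hdet' : ∀ n, Complex.normSq (p' n) * Complex.normSq (r' n) = 1)
    (hAB : UnitarilyEquiv A B) :
    ∃ j : ℤ, ∀ m : ℕ, gramTrace p' q' r' (j + m) = gramTrace p q r m := by
  obtain ⟨U, hU⟩ := hAB
  let z₀ : WithLp 2 (H × H) := WithLp.toLp 2 (e 0, 0)
  have hz₀ : z₀ ≠ 0 := by
    intro h
    have h0 : z₀.fst 0 = 0 := by rw [h]; rfl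
    exact one_ne_zero ((e_apply_self 0).symm.trans h0)
  obtain ⟨j, hj⟩ : ∃ j, ¬ VanishesAt (U z₀) j := by
    by_contra! hall
    refine hz₀ (U.map_eq_zero_iff.mp (WithLp.ofLp_injective 2 (Prod.ext ?_ ?_)))
    · ext m
      exact (hall m).1
    · ext m
      exact (hall m).2
  refine ⟨j, fun m => ?_⟩
  obtain ⟨z, hz, hUz⟩ : ∃ z, (∀ i ≠ (m : ℤ), VanishesAt z i) ∧ ¬ VanishesAt (U z) (j + m) := by
    induction m with
    | zero =>
      refine ⟨z₀, fun i hi => ⟨e_apply_of_ne hi, rfl⟩, ?_⟩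
      simpa using hj
    | succ m ih =>
      obtain ⟨z, hz, hUz⟩ := ih
      refine ⟨A z, fun i hi => ?_, fun h => hUz (hB.vanishesAt_of_apply hdet' ?_)⟩
      · have := hA.vanishesAt_apply (hz (i - 1) (by push_cast at hi; omega))
        rwa [sub_add_cancel] at this
      · rw [← hU, add_assoc]
        exact_mod_cast h
  refine hB.gramTrace_eq hdet' hUz ?_
  rw [← map_gramQuadratic hU, hA.gramQuadratic_eq_zero hdet hz, map_zero]

end IsBlockShift

lemma int_add_mul_int_add_pos {a b : ℝ} (ha : 0 < a) (ha' : a < 1) (hb : 0 < b) (hb' : b < 1)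
    (n : ℤ) : 0 < ((n : ℝ) + a) * (n + b) := by
  rcases le_or_gt 0 n with h | h
  · have : (0 : ℝ) ≤ n := by exact_mod_cast h
    positivity
  · have : (n : ℝ) ≤ -1 := by exact_mod_cast Int.le_sub_one_of_lt h
    exact mul_pos_of_neg_of_neg (by linarith) (by linarith)

lemma normSq_wT {a b : ℝ} (ha : 0 < a) (ha' : a < 1) (hb : 0 < b) (hb' : b < 1) (n : ℤ) :
    Complex.normSq (wT a b n) = ((n : ℝ) + a) / (n + b) := by
  have h := int_add_mul_int_add_pos ha ha' hb hb' n
  rw [wT, Complex.normSq_ofReal, Real.mul_self_sqrt]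
  rw [div_nonneg_iff]
  rcases mul_pos_iff.mp h with h | h
  · exact .inl ⟨h.1.le, h.2.le⟩
  · exact .inr ⟨h.1.le, h.2.le⟩

lemma gramTrace_wT {a b : ℝ} (α : ℝ) (ha : 0 < a) (ha' : a < 1) (hb : 0 < b) (hb' : b < 1)
    (n : ℤ) :
    gramTrace (wT a b) (fun n => α * (wT a b n - wT b a n)) (wT b a) n =
      2 + (1 + α ^ 2) * (b - a) ^ 2 / (((n : ℝ) + a) * (n + b)) := by
  have h := (int_add_mul_int_add_pos ha ha' hb hb' n).ne'
  have h1 : (n : ℝ) + a ≠ 0 := left_ne_zero_of_mul h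
  have h2 : (n : ℝ) + b ≠ 0 := right_ne_zero_of_mul h
  have hx := normSq_wT ha ha' hb hb' n
  have hy := normSq_wT hb hb' ha ha' n
  have hinv : Real.sqrt (((n : ℝ) + b) / (n + a)) = (Real.sqrt (((n : ℝ) + a) / (n + b)))⁻¹ := by
    rw [← Real.sqrt_inv, inv_div]
  have hxy : Real.sqrt (((n : ℝ) + a) / (n + b)) * Real.sqrt (((n : ℝ) + b) / (n + a)) = 1 := by
    rw [hinv]
    refine mul_inv_cancel₀ fun h0 => ?_
    rw [wT, h0] at hx
    simp only [Complex.ofReal_zero, map_zero] at hx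
    exact div_ne_zero h1 h2 hx.symm
  have hq : Complex.normSq (α * (wT a b n - wT b a n)) =
      α ^ 2 * (((n : ℝ) + a) / (n + b) + (n + b) / (n + a) - 2) := by
    rw [← hx, ← hy, wT, wT, ← Complex.ofReal_sub, ← Complex.ofReal_mul]
    simp only [Complex.normSq_ofReal]
    linear_combination (-2 * α ^ 2) * hxy
  rw [gramTrace, hq, hx, hy]
  field_simp
  ring

lemma wB_denom_ne_zero (l : ℝ) {k : ℝ} (hk : 0 < k) (n : ℤ) :
    (n : ℂ) + (1 + (l : ℂ)) / 2 - Complex.I * (k : ℂ) ≠ 0 := by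
  intro h
  have := congrArg Complex.im h
  simp at this
  exact hk.ne' this

lemma normSq_wB_denom (l k : ℝ) (n : ℤ) :
    Complex.normSq ((n : ℂ) + (1 + (l : ℂ)) / 2 - Complex.I * (k : ℂ)) =
      ((n : ℝ) + (1 + l) / 2) ^ 2 + k ^ 2 := by
  simp [Complex.normSq_apply]
  ring

lemma normSq_wB (l : ℝ) {k : ℝ} (hk : 0 < k) (n : ℤ) : Complex.normSq (wB l k n) = 1 := by
  have hpos : 0 < ((n : ℝ) + (1 + l) / 2) ^ 2 + k ^ 2 := by positivity
  have hnum : Complex.normSq ((n : ℂ) + (1 + (l : ℂ)) / 2 + Complex.I * (k : ℂ)) =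
      ((n : ℝ) + (1 + l) / 2) ^ 2 + k ^ 2 := by
    simp [Complex.normSq_apply]
    ring
  rw [wB, Complex.normSq_div, normSq_wB_denom, hnum, div_self hpos.ne']

lemma gramTrace_wB (l β : ℝ) {k : ℝ} (hk : 0 < k) (n : ℤ) :
    gramTrace (wB l k) (fun n => β * (wB l k n - 1)) (fun _ => 1) n =
      2 + 4 * β ^ 2 * k ^ 2 / (((n : ℝ) + (1 + l) / 2) ^ 2 + k ^ 2) := by
  have h : wB l k n - 1 =
      2 * Complex.I * k / ((n : ℂ) + (1 + (l : ℂ)) / 2 - Complex.I * (k : ℂ)) := by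
    have := wB_denom_ne_zero l hk n
    rw [wB, div_sub_one this]
    ring
  rw [gramTrace, normSq_wB l hk, h, Complex.normSq_mul, Complex.normSq_div, normSq_wB_denom]
  simp
  ring

/-- no `T(a, b, α)` is unitarily equivalent to any `B(λ, ik, β)`. -/
theorem stmt4 (a b α : ℝ) (ha : 0 < a) (hab : a < b) (hb : b < 1) (hα : 0 < α)
    (l k β : ℝ) (hl : -1 < l ∧ l ≤ 1) (hk : 0 < k) (hβ : 0 < β)
    (T₁ T₂ B₀ B₁ : H →L[ℂ] H)
    (hT₁ : ∀ n : ℤ, T₁ (e n) = wT a b n • e (n + 1))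
    (hT₂ : ∀ n : ℤ, T₂ (e n) = wT b a n • e (n + 1))
    (hB₀ : ∀ n : ℤ, B₀ (e n) = e (n + 1))
    (hB₁ : ∀ n : ℤ, B₁ (e n) = wB l k n • e (n + 1)) :
    ¬ UnitarilyEquiv (blockOp T₁ ((α : ℂ) • (T₁ - T₂)) T₂)
        (blockOp B₁ ((β : ℂ) • (B₁ - B₀)) B₀) := by
  intro hUE
  have ha' : a < 1 := hab.trans hb
  have hb' : 0 < b := ha.trans hab
  have hA := isBlockShift_blockOp hT₁ (IsShift.smul_sub hT₁ hT₂ α) hT₂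
  have hB₀' : IsShift (fun _ => 1) B₀ := fun n => by rw [hB₀ n, one_smul]
  have hB := isBlockShift_blockOp hB₁ (IsShift.smul_sub hB₁ hB₀' β) hB₀'
  have hdetA (n : ℤ) : Complex.normSq (wT a b n) * Complex.normSq (wT b a n) = 1 := by
    have h := (int_add_mul_int_add_pos ha ha' hb' hb n).ne'
    rw [normSq_wT ha ha' hb' hb, normSq_wT hb' hb ha ha',
      div_mul_div_cancel₀ (right_ne_zero_of_mul h), div_self (left_ne_zero_of_mul h)]
  have hdetB (n : ℤ) : Complex.normSq (wB l k n) * Complex.normSq 1 = 1 := by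
    rw [normSq_wB l hk, map_one, one_mul]
  obtain ⟨j, hj⟩ := hA.exists_gramTrace_eq hB hdetA hdetB hUE
  set K : ℝ := (1 + α ^ 2) * (b - a) ^ 2 with hK
  set L : ℝ := 4 * β ^ 2 * k ^ 2 with hL
  have hKpos : 0 < K := by
    have := sub_pos.mpr hab
    positivity
  have key (m : ℕ) : L * ((m + a) * (m + b)) = K * ((j + m + (1 + l) / 2) ^ 2 + k ^ 2) := by
    have h := hj m
    rw [gramTrace_wT α ha ha' hb' hb, gramTrace_wB l β hk, ← hK, ← hL, add_right_inj] at h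
    have h1 := (int_add_mul_int_add_pos ha ha' hb' hb m).ne'
    have h2 : (((j + m : ℤ) : ℝ) + (1 + l) / 2) ^ 2 + k ^ 2 ≠ 0 := by positivity
    rw [div_eq_div_iff h2 h1] at h
    push_cast at h
    exact h
  have k0 := key 0
  have k1 := key 1
  have k2 := key 2
  push_cast at k0 k1 k2
  have hLK : L = K := by linear_combination (k2 - 2 * k1 + k0) / 2
  rw [hLK] at k0 k1
  have e0 := mul_left_cancel₀ hKpos.ne' k0
  have e1 := mul_left_cancel₀ hKpos.ne' k1
  have hc : (j : ℝ) + (1 + l) / 2 = (a + b) / 2 := by linear_combination (e0 - e1) / 2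
  have hsq : ((j : ℝ) + (1 + l) / 2) ^ 2 = ((a + b) / 2) ^ 2 := by rw [hc]
  nlinarith [sq_nonneg (a - b), pow_pos hk 2]
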